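/- For every sequence s : ℕ → ℝ, the shifted Hankel determinants D_{1,n}(s) = det(a_{i+j+1,0}(s))_{i,j=0}^{n-1} satisfy the three-term recurrence D_{1,n}(s) = s_{n-1} · D_{1,n-1}(s) - D_{1,n-2}(s) for all n ≥ 2, with initial values D_{1,0}(s) = 1 and D_{1,1}(s) = s_0. -/

import Mathlib

/-- The Catalan-like array `a_{n,k}(s)` for natural indices. -/
def catA (s : ℕ → ℝ) : ℕ → ℕ → ℝ
  | 0, k => if k = 0 then 1 else 0
  | n + 1, k => (if k = 0 then 0 else catA s n (k - 1)) + s k * catA s n k + catA s n (k + 1)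

/-- The array extended to integer indices, vanishing for `n < 0` or `k < 0`. -/
def catAZ (s : ℕ → ℝ) (n k : ℤ) : ℝ :=
  if 0 ≤ n ∧ 0 ≤ k then catA s n.toNat k.toNat else 0

/-- Hankel determinant `D_{m,k,n}(s) = det (a_{i+j+m,k}(s))_{i,j=0}^{n-1}`. -/
def hankelD (s : ℕ → ℝ) (m : ℤ) (k n : ℕ) : ℝ :=
  Matrix.det (Matrix.of fun i j : Fin n => catAZ s ((i : ℤ) + (j : ℤ) + m) (k : ℤ))

open Finset Matrix

/-- The array `catA` is lower triangular. -/
lemma catA_eq_zero_of_lt (s : ℕ → ℝ) {n k : ℕ} (h : n < k) : catA s n k = 0 := by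
  induction n generalizing k with
  | zero => simp [catA, h.ne']
  | succ n ih =>
    rw [catA, ih (by omega : n < k), ih (by omega : n < k + 1), ih (by omega : n < k - 1)]
    simp

/-- The diagonal entries of `catA` are equal to one. -/
lemma catA_self (s : ℕ → ℝ) (n : ℕ) : catA s n n = 1 := by
  induction n with
  | zero => simp [catA]
  | succ n ih =>
    rw [catA, catA_eq_zero_of_lt s (by omega : n < n + 1),
      catA_eq_zero_of_lt s (by omega : n < n + 1 + 1)]
    simp [ih]

/-- Moving one step between two rows of `catA` changes their inner product by a boundary term. -/
lemma sum_catA_succ_mul (s : ℕ → ℝ) (i j N : ℕ) :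
    ∑ k ∈ range (N + 1), catA s (i + 1) k * catA s j k =
      ∑ k ∈ range (N + 1), catA s i k * catA s (j + 1) k
        + catA s i (N + 1) * catA s j N - catA s i N * catA s j (N + 1) := by
  induction N with
  | zero => simp [catA]; ring
  | succ N ih =>
    rw [sum_range_succ, ih, sum_range_succ _ (N + 1)]
    simp only [catA, Nat.add_sub_cancel, if_neg (Nat.succ_ne_zero N)]
    ring

/-- The inner product of two rows of `catA` is an entry of its first column. -/
lemma sum_catA_mul_catA (s : ℕ → ℝ) {i N : ℕ} (j : ℕ) (h : i < N) :
    ∑ k ∈ range N, catA s i k * catA s j k = catA s (i + j) 0 := by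
  induction i generalizing j with
  | zero => simp [catA, h.ne']
  | succ i ih =>
    obtain ⟨M, rfl⟩ : ∃ M, N = M + 1 := ⟨N - 1, by omega⟩
    rw [sum_catA_succ_mul, ih (j + 1) (by omega), catA_eq_zero_of_lt s (by omega : i < M),
      catA_eq_zero_of_lt s (by omega : i < M + 1)]
    simp [Nat.add_assoc, Nat.add_comm 1 j]

/-- The entries of the tridiagonal matrix with diagonal `s` and off-diagonal entries one. -/
def jacobiEntry (s : ℕ → ℝ) (l k : ℕ) : ℝ :=
  (if l + 1 = k then 1 else 0) + (if l = k then s k else 0) + (if l = k + 1 then 1 else 0)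

/-- The `n × n` tridiagonal matrix with diagonal `s` and off-diagonal entries one. -/
def jacobiMatrix (s : ℕ → ℝ) (n : ℕ) : Matrix (Fin n) (Fin n) ℝ :=
  of fun l k => jacobiEntry s l k

/-- The lower unitriangular matrix formed by the first `n` rows and columns of `catA`. -/
def catAMatrix (s : ℕ → ℝ) (n : ℕ) : Matrix (Fin n) (Fin n) ℝ :=
  of fun i k => catA s i k

lemma sum_catA_mul_jacobiEntry (s : ℕ → ℝ) {j k n : ℕ} (hj : j < n) (hk : k < n) :
    ∑ l ∈ range n, catA s j l * jacobiEntry s l k = catA s (j + 1) k := by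
  have hprev : ∑ l ∈ range n, (if l + 1 = k then catA s j l else 0) =
      if k = 0 then 0 else catA s j (k - 1) := by
    cases k with
    | zero => simp
    | succ k => simp [show k < n by omega]
  have hnext : ∑ l ∈ range n, (if l = k + 1 then catA s j l else 0) = catA s j (k + 1) := by
    rw [sum_ite_eq' (range n)]
    split_ifs with h
    · rfl
    · rw [mem_range] at h
      exact (catA_eq_zero_of_lt s (by omega)).symm
  simp only [jacobiEntry, mul_add, sum_add_distrib, mul_ite, mul_one, mul_zero, hprev, hnext,
    sum_ite_eq', mem_range, hk, if_true, catA]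
  ring

lemma det_catAMatrix (s : ℕ → ℝ) (n : ℕ) : (catAMatrix s n).det = 1 := by
  rw [det_of_isLowerTriangular]
  · simp [catAMatrix, catA_self]
  · intro i j h
    exact catA_eq_zero_of_lt s (Fin.lt_def.mp (by simpa using h))

/-- The once shifted Hankel determinant is the determinant of the tridiagonal matrix. -/
lemma hankelD_one_zero (s : ℕ → ℝ) (n : ℕ) : hankelD s 1 0 n = (jacobiMatrix s n).det := by
  have hfac : (of fun i j : Fin n => catAZ s ((i : ℤ) + (j : ℤ) + 1) ((0 : ℕ) : ℤ)) =
      catAMatrix s n * (catAMatrix s n * jacobiMatrix s n)ᵀ := by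
    ext i j
    have hrow (k : Fin n) : (catAMatrix s n * jacobiMatrix s n) j k = catA s (j + 1) k := by
      rw [mul_apply, ← sum_catA_mul_jacobiEntry s j.2 k.2, ← Fin.sum_univ_eq_sum_range]
      rfl
    have hnat : ((i : ℤ) + (j : ℤ) + 1) = (((i : ℕ) + ((j : ℕ) + 1) : ℕ) : ℤ) := by
      push_cast; ring
    rw [mul_apply]
    simp only [transpose_apply, hrow]
    simp only [of_apply, catAMatrix]
    rw [Fin.sum_univ_eq_sum_range (fun k => catA s i k * catA s (j + 1) k),
      sum_catA_mul_catA s _ i.2, hnat, catAZ, if_pos ⟨by positivity, by positivity⟩]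
    rfl
  rw [hankelD, hfac, det_mul, det_transpose, det_mul, det_catAMatrix]
  ring

/-- The minor of the tridiagonal matrix that omits the last row and the column before the last. -/
lemma det_jacobiMatrix_minor (s : ℕ → ℝ) (n : ℕ) :
    ((jacobiMatrix s (n + 2)).submatrix Fin.castSucc
      (Fin.last n).castSucc.succAbove).det = (jacobiMatrix s n).det := by
  rw [det_succ_column _ (Fin.last n), Fin.sum_univ_castSucc, sum_eq_zero]
  · have hsub : (((jacobiMatrix s (n + 2)).submatrix Fin.castSucc
        (Fin.last n).castSucc.succAbove).submatrix (Fin.last n).succAbove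
          (Fin.last n).succAbove) = jacobiMatrix s n := by
      ext i j
      have hj : (Fin.last n).castSucc.succAbove j.castSucc = j.castSucc.castSucc :=
        Fin.succAbove_of_castSucc_lt _ _ (by simp [Fin.lt_def])
      simp [jacobiMatrix, hj]
    rw [hsub]
    simp [jacobiMatrix, jacobiEntry, ← two_mul, show n ≠ n + 1 + 1 by omega]
  · intro i _
    have hi := i.2
    simp [jacobiMatrix, jacobiEntry, hi.ne, show (i : ℕ) ≠ n + 1 by omega,
      show (i : ℕ) ≠ n + 1 + 1 by omega]

lemma det_jacobiMatrix_add_two (s : ℕ → ℝ) (n : ℕ) :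
    (jacobiMatrix s (n + 2)).det =
      s (n + 1) * (jacobiMatrix s (n + 1)).det - (jacobiMatrix s n).det := by
  rw [det_succ_row _ (Fin.last (n + 1)), Fin.sum_univ_castSucc, Fin.sum_univ_castSucc,
    sum_eq_zero]
  · have hsub : (jacobiMatrix s (n + 2)).submatrix Fin.castSucc Fin.castSucc =
        jacobiMatrix s (n + 1) := rfl
    have hsign : (-1 : ℝ) ^ (n + 1 + n) = -1 := Odd.neg_one_pow ⟨n, by ring⟩
    have hsign' : (-1 : ℝ) ^ (n + 1 + (n + 1)) = 1 := Even.neg_one_pow ⟨n + 1, rfl⟩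
    simp only [Fin.succAbove_last, hsub, det_jacobiMatrix_minor]
    simp [jacobiMatrix, jacobiEntry, hsign, hsign', show n + 1 + 1 ≠ n by omega]
    ring
  · intro i _
    have hi := i.2
    simp [jacobiMatrix, jacobiEntry, hi.ne', show n + 1 + 1 ≠ (i : ℕ) by omega,
      show n + 1 ≠ (i : ℕ) by omega]

/-- Identity (3), second part: `D_{1,n}(s) = s_{n-1} D_{1,n-1}(s) - D_{1,n-2}(s)`
for `n ≥ 2`, with `D_{1,0}(s) = 1` and `D_{1,1}(s) = s₀`. -/
theorem hankel_one_shift_recurrence (s : ℕ → ℝ) :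
    hankelD s 1 0 0 = 1 ∧ hankelD s 1 0 1 = s 0 ∧
      ∀ n : ℕ, 2 ≤ n →
        hankelD s 1 0 n = s (n - 1) * hankelD s 1 0 (n - 1) - hankelD s 1 0 (n - 2) := by
  simp only [hankelD_one_zero]
  refine ⟨det_fin_zero, by simp [jacobiMatrix, jacobiEntry], fun n hn => ?_⟩
  obtain ⟨m, rfl⟩ := Nat.exists_eq_add_of_le' hn
  exact det_jacobiMatrix_add_two s m
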